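/- Let d ≥ 1 and let S be a set of exactly d vertices of the hypercube graph Q_d that separates two vertices a and b of Q_d not in S (i.e., every path from a to b in Q_d contains a vertex of S). Then S is an independent set: no two vertices of S are adjacent in Q_d. -/

import Mathlib

/-- The hypercube graph `Q_d`: vertices are functions `Fin d → Bool`, two vertices
being adjacent iff they differ in exactly one coordinate. -/
def cubeGraph (d : ℕ) : SimpleGraph (Fin d → Bool) where
  Adj x y := hammingDist x y = 1
  symm := ⟨fun x y h => by rwa [hammingDist_comm]⟩
  loopless := ⟨fun x h => by simp [hammingDist_self] at h⟩

/-- A graph `G` is `k`-linked if it has at least `2k` vertices and, for every choice of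
`2k` distinct vertices `s 0, …, s (k-1), t 0, …, t (k-1)`, there exist `k` pairwise
vertex-disjoint paths, the `i`-th joining `s i` to `t i`. -/
def IsLinked {V : Type*} (G : SimpleGraph V) (k : ℕ) : Prop :=
  2 * k ≤ Nat.card V ∧
    ∀ s t : Fin k → V, Function.Injective (Sum.elim s t) →
      ∃ P : (i : Fin k) → G.Walk (s i) (t i),
        (∀ i, (P i).IsPath) ∧
        ∀ i j, i ≠ j → ∀ v, v ∈ (P i).support → v ∉ (P j).support

theorem hammingDist_eq_add_removeNth {n : ℕ} (i : Fin (n + 1)) (x y : Fin (n + 1) → Bool) :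
    hammingDist x y =
      (if x i ≠ y i then 1 else 0) + hammingDist (i.removeNth x) (i.removeNth y) := by
  simp only [hammingDist, Finset.card_filter]
  rw [Fin.sum_univ_succAbove _ i]
  rfl

theorem cubeGraph_adj_insertNth_iff {n : ℕ} (i : Fin (n + 1)) (c : Bool) (u v : Fin n → Bool) :
    (cubeGraph (n + 1)).Adj (i.insertNth c u) (i.insertNth c v) ↔ (cubeGraph n).Adj u v := by
  simp [cubeGraph, hammingDist_eq_add_removeNth i]

theorem cubeGraph_adj_insertNth_not {n : ℕ} (i : Fin (n + 1)) (c : Bool) (u : Fin n → Bool) :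
    (cubeGraph (n + 1)).Adj (i.insertNth c u) (i.insertNth (!c) u) := by
  simp [cubeGraph, hammingDist_eq_add_removeNth i]

theorem exists_eq_insertNth_of_cubeGraph_adj {n : ℕ} {x y : Fin (n + 1) → Bool}
    (h : (cubeGraph (n + 1)).Adj x y) :
    ∃ (i : Fin (n + 1)) (u : Fin n → Bool),
      x = i.insertNth (x i) u ∧ y = i.insertNth (!x i) u := by
  obtain ⟨i, hi⟩ := Function.ne_iff.1 h.ne
  have h1 : hammingDist x y = 1 := h
  rw [hammingDist_eq_add_removeNth i, if_pos hi] at h1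
  have h2 : i.removeNth x = i.removeNth y := hammingDist_eq_zero.1 (by omega)
  refine ⟨i, i.removeNth x, by simp, ?_⟩
  rw [h2, Bool.eq_not.2 hi, Bool.not_not]
  simp

/-- Any two vertices outside `S` are joined by a walk in `Q_n` avoiding `S`. -/
def CubeConnectedOff {n : ℕ} (S : Finset (Fin n → Bool)) : Prop :=
  ∀ a ∉ S, ∀ b ∉ S, ∃ p : (cubeGraph n).Walk a b, ∀ v ∈ p.support, v ∉ S

/-- The part of `S` in the facet of `Q_{n+1}` whose `i`-th coordinate is `c`. -/
def cubeFacet {n : ℕ} (S : Finset (Fin (n + 1) → Bool)) (i : Fin (n + 1)) (c : Bool) :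
    Finset (Fin n → Bool) :=
  {u | i.insertNth c u ∈ S}

section Facets

variable {n : ℕ} {S : Finset (Fin (n + 1) → Bool)} {i : Fin (n + 1)} {c : Bool}

theorem mem_cubeFacet {u : Fin n → Bool} : u ∈ cubeFacet S i c ↔ i.insertNth c u ∈ S := by
  simp [cubeFacet]

theorem removeNth_mem_cubeFacet {x : Fin (n + 1) → Bool} :
    i.removeNth x ∈ cubeFacet S i (x i) ↔ x ∈ S := by
  simp [mem_cubeFacet]

theorem card_cubeFacet_add (S : Finset (Fin (n + 1) → Bool)) (i : Fin (n + 1)) (c : Bool) :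
    (cubeFacet S i c).card + (cubeFacet S i (!c)).card = S.card := by
  have key : ∀ e, (cubeFacet S i e).card = (S.filter (fun x => x i = e)).card := by
    intro e
    refine Finset.card_bij' (fun u _ => i.insertNth e u) (fun x _ => i.removeNth x) ?_ ?_ ?_ ?_
    · intro u hu
      simpa [mem_cubeFacet] using hu
    · intro x hx
      obtain ⟨hxS, rfl⟩ := Finset.mem_filter.1 hx
      exact removeNth_mem_cubeFacet.2 hxS
    · intro u _
      simp
    · intro x hx
      obtain ⟨hx, rfl⟩ := Finset.mem_filter.1 hx
      simp
  rw [key, key, ← Finset.card_filter_add_card_filter_not (s := S) (fun x => x i = c)]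
  simp [Bool.eq_not]

theorem CubeConnectedOff.exists_walk_insertNth (h : CubeConnectedOff (cubeFacet S i c))
    {u v : Fin n → Bool} (hu : u ∉ cubeFacet S i c) (hv : v ∉ cubeFacet S i c) :
    ∃ p : (cubeGraph (n + 1)).Walk (i.insertNth c u) (i.insertNth c v),
      ∀ w ∈ p.support, w ∉ S := by
  obtain ⟨p, hp⟩ := h u hu v hv
  let f : cubeGraph n →g cubeGraph (n + 1) :=
    ⟨fun u => i.insertNth c u, fun h => (cubeGraph_adj_insertNth_iff i c _ _).2 h⟩
  refine ⟨p.map f, fun w hw => ?_⟩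
  rw [SimpleGraph.Walk.support_map, List.mem_map] at hw
  obtain ⟨w, hw, rfl⟩ := hw
  exact fun h => hp w hw (mem_cubeFacet.2 h)

/-- If every vertex `a ∉ S` can be joined off `S` to a connected facet, then `Q_{n+1} - S` is
connected. -/
theorem cubeConnectedOff_of_forall_exists_walk (h : CubeConnectedOff (cubeFacet S i c))
    (hwalk : ∀ a ∉ S, ∃ u, ∃ p : (cubeGraph (n + 1)).Walk a (i.insertNth c u),
      ∀ w ∈ p.support, w ∉ S) : CubeConnectedOff S := by
  intro a ha b hb
  obtain ⟨u, p, hp⟩ := hwalk a ha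
  obtain ⟨v, q, hq⟩ := hwalk b hb
  obtain ⟨r, hr⟩ := h.exists_walk_insertNth (u := u) (v := v)
    (fun h => hp _ p.end_mem_support (mem_cubeFacet.1 h))
    (fun h => hq _ q.end_mem_support (mem_cubeFacet.1 h))
  refine ⟨(p.append r).append q.reverse, fun w hw => ?_⟩
  simp only [SimpleGraph.Walk.mem_support_append_iff, SimpleGraph.Walk.support_reverse,
    List.mem_reverse] at hw
  rcases hw with (hw | hw) | hw
  exacts [hp w hw, hr w hw, hq w hw]

theorem cubeConnectedOff_of_facet_subset (h : CubeConnectedOff (cubeFacet S i c))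
    (hsub : cubeFacet S i c ⊆ cubeFacet S i (!c)) : CubeConnectedOff S := by
  refine cubeConnectedOff_of_forall_exists_walk h fun a ha => ⟨i.removeNth a, ?_⟩
  by_cases hc : a i = c
  · subst hc
    exact ⟨SimpleGraph.Walk.nil.copy rfl (by simp), by simpa using ha⟩
  · obtain rfl : c = !a i := by cases h : a i <;> simp_all
    have hadj := cubeGraph_adj_insertNth_not i (a i) (i.removeNth a)
    rw [Fin.insertNth_self_removeNth] at hadj
    refine ⟨hadj.toWalk, fun w hw => ?_⟩
    simp only [SimpleGraph.Adj.toWalk, SimpleGraph.Walk.support_cons,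
      SimpleGraph.Walk.support_nil, List.mem_cons, List.not_mem_nil, or_false] at hw
    rcases hw with rfl | rfl
    · exact ha
    · intro hS
      have := hsub (mem_cubeFacet.2 hS)
      rw [Bool.not_not] at this
      exact ha (removeNth_mem_cubeFacet.1 this)

theorem cubeConnectedOff_of_facets (h : ∀ c, CubeConnectedOff (cubeFacet S i c))
    (hcard : (cubeFacet S i true ∪ cubeFacet S i false).card < 2 ^ n) : CubeConnectedOff S := by
  obtain ⟨w, hw⟩ : ∃ w, w ∉ cubeFacet S i true ∪ cubeFacet S i false := by
    by_contra! hall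
    rw [Finset.eq_univ_of_forall hall] at hcard
    simp at hcard
  rw [Finset.mem_union, not_or] at hw
  have hw' : ∀ c, w ∉ cubeFacet S i c := Bool.forall_bool.2 ⟨hw.2, hw.1⟩
  have hT : i.insertNth true w ∉ S := fun h => hw.1 (mem_cubeFacet.2 h)
  refine cubeConnectedOff_of_forall_exists_walk (h true) fun a ha => ⟨w, ?_⟩
  obtain ⟨p, hp⟩ := (h (a i)).exists_walk_insertNth
    (fun h => ha (removeNth_mem_cubeFacet.1 h)) (hw' (a i))
  have hstart : i.insertNth (a i) (i.removeNth a) = a := Fin.insertNth_self_removeNth i a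
  by_cases hc : a i = true
  · exact ⟨p.copy hstart (by rw [hc]), by simpa using hp⟩
  · have hadj := cubeGraph_adj_insertNth_not i (a i) w
    refine ⟨(p.concat hadj).copy hstart (by simp [hc]), fun v hv => ?_⟩
    simp only [SimpleGraph.Walk.support_copy, SimpleGraph.Walk.support_concat,
      List.mem_append, List.mem_singleton] at hv
    rcases hv with hv | rfl
    · exact hp v hv
    · simpa [hc] using hT

end Facets

theorem cubeConnectedOff_of_subsingleton {n : ℕ} {S : Finset (Fin n → Bool)}
    (h : ∀ a ∉ S, ∀ b ∉ S, a = b) : CubeConnectedOff S := by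
  intro a ha b hb
  obtain rfl := h a ha b hb
  exact ⟨.nil, by simpa using ha⟩

theorem cubeConnectedOff_of_card_lt {n : ℕ} {S : Finset (Fin n → Bool)} (hS : S.card < n) :
    CubeConnectedOff S := by
  induction n with
  | zero => omega
  | succ n ih =>
    by_cases hne : S.card ≤ 1
    · obtain ⟨c, hc⟩ : ∃ c, cubeFacet S 0 c = ∅ := by
        have := card_cubeFacet_add S 0 true
        by_contra! h
        have h1 := (h true).card_pos
        have h2 := (h (!true)).card_pos
        omega
      refine cubeConnectedOff_of_facet_subset (i := 0) (c := c) ?_ (by simp [hc])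
      rcases n.eq_zero_or_pos with rfl | hn
      · exact cubeConnectedOff_of_subsingleton fun a _ b _ => Subsingleton.elim a b
      · exact ih (by simpa [hc] using hn)
    · obtain ⟨s, hs, t, ht, hst⟩ := Finset.one_lt_card.1 (not_le.1 hne)
      obtain ⟨i, hi⟩ := Function.ne_iff.1 hst
      have hsum := card_cubeFacet_add S i (s i)
      have h1 := Finset.card_pos.2 ⟨_, removeNth_mem_cubeFacet (i := i).2 hs⟩
      have h2 := Finset.card_pos.2 ⟨_, removeNth_mem_cubeFacet (i := i).2 ht⟩
      rw [Bool.eq_not.2 hi.symm] at h2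
      refine cubeConnectedOff_of_facets (i := i) (fun c => ih ?_) ?_
      · by_cases hc : c = s i
        · subst hc; omega
        · rw [Bool.eq_not.2 hc]; omega
      · have := Finset.card_union_le (cubeFacet S i true) (cubeFacet S i false)
        have := card_cubeFacet_add S i true
        have := n.lt_two_pow_self
        simp only [Bool.not_true] at *
        omega

theorem cubeConnectedOff_of_adj {n : ℕ} {S : Finset (Fin n → Bool)} (hS : S.card ≤ n)
    {x y : Fin n → Bool} (hx : x ∈ S) (hy : y ∈ S) (hxy : (cubeGraph n).Adj x y) :
    CubeConnectedOff S := by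
  cases n with
  | zero => exact absurd (Subsingleton.elim x y) hxy.ne
  | succ n =>
    obtain ⟨i, u, hxu, hyu⟩ := exists_eq_insertNth_of_cubeGraph_adj hxy
    have hu : ∀ c, u ∈ cubeFacet S i c := by
      intro c
      rw [mem_cubeFacet]
      by_cases hc : c = x i
      · rwa [hc, ← hxu]
      · rwa [Bool.eq_not.2 hc, ← hyu]
    by_cases hlt : ∀ c, (cubeFacet S i c).card < n
    · refine cubeConnectedOff_of_facets (i := i) (fun c => cubeConnectedOff_of_card_lt (hlt c)) ?_
      have := Finset.card_union_add_card_inter (cubeFacet S i true) (cubeFacet S i false)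
      have := Finset.card_pos.2 ⟨u, Finset.mem_inter.2 ⟨hu true, hu false⟩⟩
      have := card_cubeFacet_add S i true
      have := n.lt_two_pow_self
      simp only [Bool.not_true] at *
      omega
    · push Not at hlt
      obtain ⟨c, hc⟩ := hlt
      have hsum := card_cubeFacet_add S i c
      have hpos := Finset.card_pos.2 ⟨u, hu c⟩
      have hpos' := Finset.card_pos.2 ⟨u, hu (!c)⟩
      obtain ⟨u', hu'⟩ := Finset.card_eq_one.1 (show (cubeFacet S i (!c)).card = 1 by omega)
      obtain rfl : u = u' := by simpa [hu'] using hu (!c)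
      refine cubeConnectedOff_of_facet_subset (i := i) (c := !c) ?_ ?_
      · by_cases hn : 1 < n
        · exact cubeConnectedOff_of_card_lt (by simpa [hu'] using hn)
        · obtain rfl : n = 1 := by omega
          refine cubeConnectedOff_of_subsingleton fun a ha b hb => ?_
          simp only [hu', Finset.mem_singleton, funext_iff, Fin.forall_fin_one] at ha hb ⊢
          rw [Bool.eq_not.2 ha, Bool.eq_not.2 hb]
      · rw [hu', Finset.singleton_subset_iff]
        exact hu _

theorem cube_separator_independent (d : ℕ) (hd : 1 ≤ d) (S : Set (Fin d → Bool))
    (hScard : S.ncard = d) (a b : Fin d → Bool) (ha : a ∉ S) (hb : b ∉ S)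
    (hsep : ∀ p : (cubeGraph d).Walk a b, p.IsPath → ∃ v ∈ p.support, v ∈ S) :
    ∀ x ∈ S, ∀ y ∈ S, ¬ (cubeGraph d).Adj x y := by
  intro x hx y hy hxy
  lift S to Finset (Fin d → Bool) using S.toFinite
  rw [Set.ncard_coe_finset] at hScard
  obtain ⟨p, hp⟩ := cubeConnectedOff_of_adj hScard.le hx hy hxy a ha b hb
  obtain ⟨v, hv, hvS⟩ := hsep p.bypass p.bypass_isPath
  exact hp v (p.support_bypass_subset_support hv) hvS
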